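/- Let p be an odd prime. Any two effective orthogonal actions of ℤ/p × ℤ/p on ℝ⁵ are equivalent modulo precomposition with an automorphism of the group: if ρ₁, ρ₂ : ℤ/p × ℤ/p → O(5) are injective group homomorphisms into the group of linear isometries of ℝ⁵ (Euclidean 5-space), then there exist a group automorphism φ of ℤ/p × ℤ/p and a linear isometry A of ℝ⁵ such that ρ₂(g) = A ∘ ρ₁(φ(g)) ∘ A⁻¹ for every g. In particular, every effective orthogonal action of ℤ/p × ℤ/p on ℝ⁵ (p odd) is equivalent, modulo an automorphism of the group, to the standard linear action. -/

import Mathlib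

open scoped RealInnerProductSpace

namespace EffOrth

/-- The Euclidean space of dimension five. -/
abbrev V5 := EuclideanSpace ℝ (Fin 5)

/-- Cosine part of the standard character. -/
noncomputable def C (p : ℕ) [NeZero p] (t : ZMod p) : ℝ := (ZMod.stdAddChar t : ℂ).re

/-- Sine part of the standard character. -/
noncomputable def S (p : ℕ) [NeZero p] (t : ZMod p) : ℝ := (ZMod.stdAddChar t : ℂ).im

section trig
variable {p : ℕ} [NeZero p]

lemma C_zero : C p 0 = 1 := by simp [C]
lemma S_zero : S p 0 = 0 := by simp [S]
lemma C_add (a b : ZMod p) : C p (a + b) = C p a * C p b - S p a * S p b := by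
  simp [C, S, AddChar.map_add_eq_mul]
lemma S_add (a b : ZMod p) : S p (a + b) = C p a * S p b + S p a * C p b := by
  simp [C, S, AddChar.map_add_eq_mul]
lemma CS (a : ZMod p) : C p a ^ 2 + S p a ^ 2 = 1 := by
  have h : ‖(ZMod.stdAddChar a : ℂ)‖ = 1 := by simp
  have h2 := Complex.sq_norm (ZMod.stdAddChar a : ℂ)
  rw [h, Complex.normSq_apply] at h2
  simp only [C, S]; linarith
lemma C_neg (a : ZMod p) : C p (-a) = C p a := by
  have h1 := C_add a (-a)
  have h2 := S_add a (-a)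
  have h3 := CS a
  rw [add_neg_cancel, C_zero] at h1
  rw [add_neg_cancel, S_zero] at h2
  linear_combination (-C p (-a)) * h3 - C p a * h1 - S p a * h2
lemma S_neg (a : ZMod p) : S p (-a) = - S p a := by
  have h1 := C_add a (-a)
  have h2 := S_add a (-a)
  have h3 := CS a
  rw [add_neg_cancel, C_zero] at h1
  rw [add_neg_cancel, S_zero] at h2
  linear_combination (-S p (-a)) * h3 + S p a * h1 - C p a * h2

lemma S_ne (hodd : Odd p) {t : ZMod p} (ht : t ≠ 0) : S p t ≠ 0 := by
  intro h
  apply ht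
  have h1 : (ZMod.stdAddChar (t + t) : ℂ) = ZMod.stdAddChar (0 : ZMod p) := by
    have h3 := CS t
    apply Complex.ext
    · change C p (t + t) = C p 0
      rw [C_add, C_zero]; rw [h] at *; linarith
    · change S p (t + t) = S p 0
      rw [S_add, S_zero, h]; ring
  have h2 := ZMod.injective_stdAddChar h1
  have h4 : (2 : ZMod p) * t = 0 := by rw [two_mul]; exact h2
  have hu : IsUnit ((2 : ℕ) : ZMod p) := (ZMod.isUnit_iff_coprime 2 p).2 (by simpa using hodd)
  exact (hu.mul_right_eq_zero).1 (by exact_mod_cast h4)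

lemma sum_C (g : ZMod p × ZMod p) :
    ∑ χ : ZMod p × ZMod p, C p (χ.1 * g.1 + χ.2 * g.2) = if g = 0 then (p : ℝ) ^ 2 else 0 := by
  have key : ∑ χ : ZMod p × ZMod p, (ZMod.stdAddChar (χ.1 * g.1 + χ.2 * g.2) : ℂ)
      = if g = 0 then (p : ℂ) ^ 2 else 0 := by
    simp_rw [AddChar.map_add_eq_mul]
    rw [Fintype.sum_prod_type]
    simp_rw [← Finset.mul_sum]
    rw [← Finset.sum_mul, AddChar.sum_mulShift _ (ZMod.isPrimitive_stdAddChar p),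
      AddChar.sum_mulShift _ (ZMod.isPrimitive_stdAddChar p)]
    obtain ⟨x, y⟩ := g
    by_cases hx : x = 0 <;> by_cases hy : y = 0 <;> simp [hx, hy, pow_two]
  have := congrArg Complex.re key
  rw [Complex.re_sum] at this
  simp only [C]
  rw [this]
  split_ifs
  · norm_cast
  · simp

end trig

/-- Pairing. -/
def pr {p : ℕ} (χ g : ZMod p × ZMod p) : ZMod p := χ.1 * g.1 + χ.2 * g.2

lemma pr_sub {p : ℕ} (χ g h : ZMod p × ZMod p) : pr χ (g - h) = pr χ g + - pr χ h := by
  simp [pr]; ring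

section act
variable {p : ℕ} [NeZero p]
  (ρ : Multiplicative (ZMod p × ZMod p) →* (V5 ≃ₗᵢ[ℝ] V5))

/-- The action written additively. -/
noncomputable def R (g : ZMod p × ZMod p) : V5 ≃ₗᵢ[ℝ] V5 := ρ (Multiplicative.ofAdd g)

lemma R_add (g h : ZMod p × ZMod p) (v : V5) : R ρ (g + h) v = R ρ g (R ρ h v) := by
  simp [R, ofAdd_add]

/-- cosine projection -/
noncomputable def U (χ : ZMod p × ZMod p) (v : V5) : V5 := ∑ g, C p (pr χ g) • R ρ g v
/-- sine projection -/
noncomputable def W (χ : ZMod p × ZMod p) (v : V5) : V5 := ∑ g, S p (pr χ g) • R ρ g v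

lemma R_U (χ h : ZMod p × ZMod p) (v : V5) :
    R ρ h (U ρ χ v) = C p (pr χ h) • U ρ χ v + S p (pr χ h) • W ρ χ v := by
  have : R ρ h (U ρ χ v) = ∑ g, C p (pr χ (g - h)) • R ρ g v := by
    rw [U, map_sum]
    refine Fintype.sum_equiv (Equiv.addLeft h) _ _ fun g => ?_
    simp [R_add]
  rw [this, U, W, Finset.smul_sum, Finset.smul_sum, ← Finset.sum_add_distrib]
  refine Finset.sum_congr rfl fun g _ => ?_
  rw [pr_sub, C_add, C_neg, S_neg]
  module

lemma R_W (χ h : ZMod p × ZMod p) (v : V5) :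
    R ρ h (W ρ χ v) = C p (pr χ h) • W ρ χ v - S p (pr χ h) • U ρ χ v := by
  have : R ρ h (W ρ χ v) = ∑ g, S p (pr χ (g - h)) • R ρ g v := by
    rw [W, map_sum]
    refine Fintype.sum_equiv (Equiv.addLeft h) _ _ fun g => ?_
    simp [R_add]
  rw [this, U, W, Finset.smul_sum, Finset.smul_sum, ← Finset.sum_sub_distrib]
  refine Finset.sum_congr rfl fun g _ => ?_
  rw [pr_sub, S_add, C_neg, S_neg]
  module

lemma sum_U (v : V5) : ∑ χ, U ρ χ v = ((p : ℝ) ^ 2) • v := by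
  simp only [U]
  rw [Finset.sum_comm]
  simp_rw [← Finset.sum_smul, pr, sum_C]
  simp [R]

/-- A pair of orthonormal vectors rotated by the action through the character `χ`. -/
structure Rot (χ : ZMod p × ZMod p) (u w : V5) : Prop where
  hu : ∀ h, R ρ h u = C p (pr χ h) • u + S p (pr χ h) • w
  hw : ∀ h, R ρ h w = C p (pr χ h) • w - S p (pr χ h) • u
  nu : ‖u‖ = 1
  nw : ‖w‖ = 1
  uw : ⟪u, w⟫ = 0

lemma exists_rot (hodd : Odd p) (hρ : Function.Injective ρ) {h : ZMod p × ZMod p} (hh : h ≠ 0) :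
    ∃ χ u w, Rot ρ χ u w ∧ pr χ h ≠ 0 := by
  have h1 : ∃ v, R ρ h v ≠ v := by
    by_contra! hc
    apply hh
    have : ρ (Multiplicative.ofAdd h) = ρ 1 := by
      rw [map_one]; ext1 v; exact hc v
    exact Multiplicative.ofAdd.injective (hρ this)
  obtain ⟨v, hv⟩ := h1
  have h2 : ∃ χ, R ρ h (U ρ χ v) ≠ U ρ χ v := by
    by_contra! hc
    apply hv
    have hp0 : ((p : ℝ) ^ 2) ≠ 0 := by
      have := NeZero.ne p
      positivity
    have h3 : R ρ h (((p : ℝ) ^ 2) • v) = ((p : ℝ) ^ 2) • v := by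
      rw [← sum_U ρ v, map_sum]
      exact Finset.sum_congr rfl fun χ _ => hc χ
    rw [map_smul] at h3
    exact smul_right_injective _ hp0 h3
  obtain ⟨χ, hχ⟩ := h2
  have hne : pr χ h ≠ 0 := by
    intro h0
    apply hχ
    rw [R_U, h0, C_zero, S_zero]; simp
  have hu := fun h => R_U ρ χ h v
  have hw := fun h => R_W ρ χ h v
  generalize U ρ χ v = u at *
  generalize W ρ χ v = w at *
  have hS := S_ne hodd hne
  have hCS := CS (pr χ h)
  have e1 : ⟪R ρ h u, R ρ h u⟫ = ⟪u, u⟫ := (R ρ h).inner_map_map u u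
  have e2 : ⟪R ρ h u, R ρ h w⟫ = ⟪u, w⟫ := (R ρ h).inner_map_map u w
  rw [hu, hw] at e2
  rw [hu] at e1
  simp only [inner_add_left, inner_add_right, inner_sub_right, inner_smul_left, inner_smul_right,
    real_inner_comm u w, RCLike.conj_to_real] at e1 e2
  have f1 : S p (pr χ h) * (⟪u, u⟫ - ⟪w, w⟫) = 2 * C p (pr χ h) * ⟪u, w⟫ := by
    apply mul_left_cancel₀ hS
    have := real_inner_comm u w
    linear_combination ⟪u, u⟫ * hCS - e1 + 0 * this
  have f2 : - 2 * S p (pr χ h) * ⟪u, w⟫ = C p (pr χ h) * (⟪u, u⟫ - ⟪w, w⟫) := by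
    apply mul_left_cancel₀ hS
    have := real_inner_comm u w
    linear_combination e2 - ⟪u, w⟫ * hCS
  have f3 : ⟪u, u⟫ = ⟪w, w⟫ := by
    linear_combination (⟪w, w⟫ - ⟪u, u⟫) * hCS + S p (pr χ h) * f1 - C p (pr χ h) * f2
  have f4 : ⟪u, w⟫ = 0 := by
    have : S p (pr χ h) * ⟪u, w⟫ = 0 := by
      rw [f3] at f2; linarith
    exact (mul_eq_zero.1 this).resolve_left hS
  have f5 : ‖w‖ = ‖u‖ := by
    rw [real_inner_self_eq_norm_sq, real_inner_self_eq_norm_sq] at f3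
    exact ((sq_eq_sq₀ (norm_nonneg _) (norm_nonneg _)).1 f3).symm
  have hu0 : ‖u‖ ≠ 0 := by
    intro h0
    apply hχ
    rw [norm_eq_zero.1 h0]; simp
  refine ⟨χ, ‖u‖⁻¹ • u, ‖u‖⁻¹ • w, ⟨fun h => ?_, fun h => ?_, ?_, ?_, ?_⟩, hne⟩
  · rw [map_smul, hu]; module
  · rw [map_smul, hw]; module
  · rw [norm_smul, norm_inv, norm_norm, inv_mul_cancel₀ hu0]
  · rw [norm_smul, norm_inv, norm_norm, f5, inv_mul_cancel₀ hu0]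
  · simp [inner_smul_left, inner_smul_right, f4]

lemma orth (hodd : Odd p) {χ : ZMod p × ZMod p} {u w x : V5} (H : Rot ρ χ u w)
    {h : ZMod p × ZMod p} (hh : pr χ h ≠ 0) (hx : R ρ h x = x) : ⟪x, u⟫ = 0 ∧ ⟪x, w⟫ = 0 := by
  have e1 : ⟪R ρ h x, R ρ h u⟫ = ⟪x, u⟫ := (R ρ h).inner_map_map x u
  have e2 : ⟪R ρ h x, R ρ h w⟫ = ⟪x, w⟫ := (R ρ h).inner_map_map x w
  have hS := S_ne hodd hh
  have hCS := CS (pr χ h)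
  rw [hx, H.hu] at e1
  rw [hx, H.hw] at e2
  simp only [inner_add_right, inner_sub_right, inner_smul_right] at e1 e2
  generalize C p (pr χ h) = c at *
  generalize S p (pr χ h) = s at *
  generalize ⟪x, u⟫ = a at *
  generalize ⟪x, w⟫ = b at *
  have g1 : s * (a ^ 2 + b ^ 2) = 0 := by linear_combination b * e1 - a * e2
  have g2 := (mul_eq_zero.1 g1).resolve_left hS
  constructor <;> nlinarith [sq_nonneg a, sq_nonneg b]

lemma normal_form (hp : p.Prime) (hodd : Odd p) (hρ : Function.Injective ρ) :
    ∃ (ψ : AddAut (ZMod p × ZMod p)) (b : OrthonormalBasis (Fin 5) ℝ V5), ∀ g,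
      R ρ g (b 0) = C p (ψ g).1 • b 0 + S p (ψ g).1 • b 1 ∧
      R ρ g (b 1) = C p (ψ g).1 • b 1 - S p (ψ g).1 • b 0 ∧
      R ρ g (b 2) = C p (ψ g).2 • b 2 + S p (ψ g).2 • b 3 ∧
      R ρ g (b 3) = C p (ψ g).2 • b 3 - S p (ψ g).2 • b 2 ∧
      R ρ g (b 4) = b 4 := by
  have : Fact p.Prime := ⟨hp⟩
  obtain ⟨χ, u, w, H, hχ⟩ := exists_rot ρ hodd hρ (h := (1, 0)) (by simp)
  have hk : ((- χ.2, χ.1) : ZMod p × ZMod p) ≠ 0 := by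
    intro h0
    rw [Prod.mk_eq_zero] at h0
    apply hχ
    simp [pr, h0.2]
  obtain ⟨η, u', w', H', hη⟩ := exists_rot ρ hodd hρ hk
  have hχk : pr χ (- χ.2, χ.1) = 0 := by simp [pr]; ring
  have ou := orth ρ hodd H' hη (x := u) (by rw [H.hu, hχk, C_zero, S_zero]; simp)
  have ow := orth ρ hodd H' hη (x := w) (by rw [H.hw, hχk, C_zero, S_zero]; simp)
  let f : (ZMod p × ZMod p) →+ (ZMod p × ZMod p) :=
    { toFun := fun g => (pr χ g, pr η g)
      map_zero' := by simp [pr]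
      map_add' := fun a b => by ext <;> simp [pr] <;> ring }
  have hf : Function.Injective f := by
    rw [injective_iff_map_eq_zero]
    intro g hg
    have hg1 : χ.1 * g.1 + χ.2 * g.2 = 0 := congrArg Prod.fst hg
    have hg2 : η.1 * g.1 + η.2 * g.2 = 0 := congrArg Prod.snd hg
    have hd : η.1 * (-χ.2) + η.2 * χ.1 ≠ 0 := hη
    ext
    · apply (mul_eq_zero.1 _).resolve_left hd
      linear_combination η.2 * hg1 - χ.2 * hg2
    · apply (mul_eq_zero.1 _).resolve_left hd
      linear_combination χ.1 * hg2 - η.1 * hg1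
  let ψ : AddAut (ZMod p × ZMod p) := AddEquiv.ofBijective f (Finite.injective_iff_bijective.1 hf)
  let v : Fin 5 → V5 := ![u, w, u', w', 0]
  have hv : Orthonormal ℝ (({4}ᶜ : Set (Fin 5)).domRestrict v) := by
    constructor
    · rintro ⟨i, hi⟩
      fin_cases i
      · exact H.nu
      · exact H.nw
      · exact H'.nu
      · exact H'.nw
      · exact absurd rfl hi
    · rintro ⟨i, hi⟩ ⟨j, hj⟩ hij
      fin_cases i <;> fin_cases j <;>
        first
          | exact absurd rfl hij
          | exact absurd rfl hi
          | exact absurd rfl hj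
          | exact H.uw
          | exact H'.uw
          | exact ou.1
          | exact ou.2
          | exact ow.1
          | exact ow.2
          | (refine (real_inner_comm _ _).trans ?_
             first
             | exact H.uw
             | exact H'.uw
             | exact ou.1
             | exact ou.2
             | exact ow.1
             | exact ow.2)
  obtain ⟨b, hb⟩ := hv.exists_orthonormalBasis_extension_of_card_eq (by simp)
  have b0 : b 0 = u := hb 0 (by simp)
  have b1 : b 1 = w := hb 1 (by simp)
  have b2 : b 2 = u' := hb 2 (by simp)
  have b3 : b 3 = w' := hb 3 (by simp)
  have ob : ∀ i j, i ≠ j → ⟪b i, b j⟫ = 0 := fun i j hij => b.orthonormal.2 hij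
  refine ⟨ψ, b, fun g => ?_⟩
  have r0 : ∀ g, R ρ g (b 0) = C p (ψ g).1 • b 0 + S p (ψ g).1 • b 1 := fun g => by
    rw [b0, b1]; exact H.hu g
  have r1 : ∀ g, R ρ g (b 1) = C p (ψ g).1 • b 1 - S p (ψ g).1 • b 0 := fun g => by
    rw [b0, b1]; exact H.hw g
  have r2 : ∀ g, R ρ g (b 2) = C p (ψ g).2 • b 2 + S p (ψ g).2 • b 3 := fun g => by
    rw [b2, b3]; exact H'.hu g
  have r3 : ∀ g, R ρ g (b 3) = C p (ψ g).2 • b 3 - S p (ψ g).2 • b 2 := fun g => by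
    rw [b2, b3]; exact H'.hw g
  refine ⟨r0 g, r1 g, r2 g, r3 g, ?_⟩
  have hz : ∀ i, i ≠ 4 → ⟪b i, R ρ g (b 4)⟫ = 0 := by
    intro i hi
    have hinv : R ρ g (R ρ (-g) (b i)) = b i := by
      rw [← R_add]; simp [R]
    rw [← hinv, LinearIsometryEquiv.inner_map_map]
    fin_cases i
    · simp [r0, inner_add_left, inner_smul_left, ob]
    · simp [r1, inner_sub_left, inner_smul_left, ob]
    · simp [r2, inner_add_left, inner_smul_left, ob]
    · simp [r3, inner_sub_left, inner_smul_left, ob]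
    · exact absurd rfl hi
  have hc : R ρ g (b 4) = ⟪b 4, R ρ g (b 4)⟫ • b 4 := by
    conv_lhs => rw [← b.sum_repr' (R ρ g (b 4))]
    rw [Finset.sum_eq_single 4]
    · intro i _ hi; rw [hz i hi, zero_smul]
    · simp
  generalize ⟪b 4, R ρ g (b 4)⟫ = c at hc
  have hcn : |c| = 1 := by
    have := congrArg norm hc
    rw [LinearIsometryEquiv.norm_map, norm_smul, b.norm_eq_one, mul_one] at this
    exact this.symm
  have hpow : ∀ n : ℕ, R ρ (n • g) (b 4) = c ^ n • b 4 := by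
    intro n
    induction n with
    | zero => simp [R]
    | succ k ih => rw [succ_nsmul, R_add, hc, map_smul, ih, smul_smul, pow_succ']
  have hpp := hpow p
  have hpg : p • g = 0 := by ext <;> simp
  rw [hpg] at hpp
  rcases (abs_eq zero_le_one).1 hcn with h1 | h1
  · rw [hc, h1, one_smul]
  · exfalso
    rw [h1, hodd.neg_one_pow] at hpp
    have h4 : b 4 = -b 4 := by simpa [R] using hpp
    have h5 : b 4 = 0 := by
      have h6 : (2 : ℝ) • b 4 = 0 := by
        rw [two_smul]; nth_rewrite 1 [h4]; simp
      exact (smul_eq_zero.1 h6).resolve_left two_ne_zero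
    have := b.norm_eq_one 4
    rw [h5] at this; simp at this

end act

end EffOrth

open EffOrth in
/-- For an odd prime `p`, any two effective orthogonal actions of `ℤ/p × ℤ/p` on `ℝ⁵` are
equivalent modulo precomposition with an automorphism of the group: there are a group
automorphism `φ` and a linear isometry `A` of `ℝ⁵` conjugating one action to the other. -/
theorem effective_orthogonal_actions_equivalent
    (p : ℕ) (hp : p.Prime) (hodd : Odd p)
    (ρ₁ ρ₂ : Multiplicative (ZMod p × ZMod p) →*
      (EuclideanSpace ℝ (Fin 5) ≃ₗᵢ[ℝ] EuclideanSpace ℝ (Fin 5)))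
    (h₁ : Function.Injective ρ₁) (h₂ : Function.Injective ρ₂) :
    ∃ (φ : AddAut (ZMod p × ZMod p))
      (A : EuclideanSpace ℝ (Fin 5) ≃ₗᵢ[ℝ] EuclideanSpace ℝ (Fin 5)),
      ∀ g : Multiplicative (ZMod p × ZMod p),
        ρ₂ g = A * ρ₁ (Multiplicative.ofAdd (φ g.toAdd)) * A⁻¹ := by
  have : NeZero p := ⟨hp.ne_zero⟩
  obtain ⟨ψ₁, b, H⟩ := normal_form ρ₁ hp hodd h₁
  obtain ⟨ψ₂, b', H'⟩ := normal_form ρ₂ hp hodd h₂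
  refine ⟨ψ₂.trans ψ₁.symm, b.equiv b' (Equiv.refl _), fun g => ?_⟩
  rw [eq_mul_inv_iff_mul_eq]
  have hA : ∀ i, b.equiv b' (Equiv.refl _) (b i) = b' i := fun i => by simp
  generalize b.equiv b' (Equiv.refl _) = A at hA ⊢
  have hψ : ψ₁ ((ψ₂.trans ψ₁.symm) g.toAdd) = ψ₂ g.toAdd := by simp
  generalize (ψ₂.trans ψ₁.symm) g.toAdd = k at hψ ⊢
  have G := H k
  have G' := H' g.toAdd
  rw [hψ] at G
  obtain ⟨a0, a1, a2, a3, a4⟩ := G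
  obtain ⟨c0, c1, c2, c3, c4⟩ := G'
  change R ρ₂ g.toAdd * A = A * R ρ₁ k
  apply LinearIsometryEquiv.toLinearEquiv_injective
  apply LinearEquiv.toLinearMap_injective
  apply b.toBasis.ext
  intro i
  change R ρ₂ g.toAdd (A (b.toBasis i)) = A (R ρ₁ k (b.toBasis i))
  rw [OrthonormalBasis.coe_toBasis, hA]
  fin_cases i
  · change R ρ₂ g.toAdd (b' 0) = A (R ρ₁ k (b 0))
    rw [a0, c0]; simp [hA]
  · change R ρ₂ g.toAdd (b' 1) = A (R ρ₁ k (b 1))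
    rw [a1, c1]; simp [hA]
  · change R ρ₂ g.toAdd (b' 2) = A (R ρ₁ k (b 2))
    rw [a2, c2]; simp [hA]
  · change R ρ₂ g.toAdd (b' 3) = A (R ρ₁ k (b 3))
    rw [a3, c3]; simp [hA]
  · change R ρ₂ g.toAdd (b' 4) = A (R ρ₁ k (b 4))
    rw [a4, c4]; simp [hA]
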